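/- Let A be a special G-Frobenius algebra and define γ_{g,h} ∈ i_{gh}(A_{gh}) ⊆ A_e by 1_g ∘ 1_h = γ_{g,h} ∘ 1_{gh}. Then γ is a G-graded 2-cocycle with values in A_e: for all g, h, k ∈ G, π_{ghk}(γ_{g,h} ∘ γ_{gh,k}) = π_{ghk}(γ_{h,k} ∘ γ_{g,hk}). Moreover γ is associative: π_{ghk}(π_{gh}(i_g(A_g) ∘ i_h(A_h)) ∘ i_k(A_k) ∘ γ_{g,h} ∘ γ_{gh,k}) = π_{ghk}(i_g(A_g) ∘ π_{hk}(i_h(A_h) ∘ i_k(A_k)) ∘ γ_{h,k} ∘ γ_{g,hk}) for all elements of the indicated subspaces. -/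

import Mathlib

/-- A `G`-twisted Frobenius algebra (G-Frobenius algebra) over a field `k`. -/
structure GFrobenius (k G A : Type*)
    [Field k] [Group G] [DecidableEq G] [AddCommGroup A] [Module k A] where
  grade : G → Submodule k A
  internal : DirectSum.IsInternal grade
  finite : FiniteDimensional k A
  mul : A →ₗ[k] A →ₗ[k] A
  one : A
  eta : A →ₗ[k] A →ₗ[k] k
  phi : G → A →ₗ[k] A
  chi : G → k
  one_mem : one ∈ grade 1
  mul_mem : ∀ g h : G, ∀ a ∈ grade g, ∀ b ∈ grade h, mul a b ∈ grade (g * h)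
  mul_assoc' : ∀ a b c : A, mul (mul a b) c = mul a (mul b c)
  twisted_comm : ∀ g h : G, ∀ a ∈ grade g, ∀ b ∈ grade h, mul a b = mul (phi g b) a
  one_mul' : ∀ a : A, mul one a = a
  mul_one' : ∀ a : A, mul a one = a
  phi_id : phi 1 = LinearMap.id
  phi_comp : ∀ g h : G, phi (g * h) = (phi g).comp (phi h)
  phi_fixes_one : ∀ g : G, phi g one = one
  eta_nondeg_left : ∀ a : A, (∀ b : A, eta a b = 0) → a = 0
  eta_nondeg_right : ∀ b : A, (∀ a : A, eta a b = 0) → b = 0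
  eta_grade : ∀ g h : G, g * h ≠ 1 → ∀ a ∈ grade g, ∀ b ∈ grade h, eta a b = 0
  eta_invariant : ∀ a b c : A, eta a (mul b c) = eta (mul a b) c
  chi_one : chi 1 = 1
  chi_mul : ∀ g h : G, chi (g * h) = chi g * chi h
  chi_ne : ∀ g : G, chi g ≠ 0
  phi_grade : ∀ g h : G, ∀ a ∈ grade h, phi g a ∈ grade (g * h * g⁻¹)
  phi_self : ∀ g : G, ∀ a ∈ grade g, phi g a = (chi g)⁻¹ • a
  phi_mul : ∀ (g : G) (a b : A), phi g (mul a b) = mul (phi g a) (phi g b)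
  phi_eta : ∀ (g : G) (a b : A), eta (phi g a) (phi g b) = ((chi g) ^ 2)⁻¹ * eta a b
  trace_axiom : ∀ g h : G, ∀ c ∈ grade (g * h * g⁻¹ * h⁻¹),
    ∀ (hf : ∀ x ∈ grade g, ((mul c).comp (phi h)) x ∈ grade g)
      (hg : ∀ x ∈ grade h, ((phi g⁻¹).comp (mul c)) x ∈ grade h),
      chi h * LinearMap.trace k ↥(grade g) (((mul c).comp (phi h)).restrict hf)
        = chi g⁻¹ * LinearMap.trace k ↥(grade h) (((phi g⁻¹).comp (mul c)).restrict hg)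

/-- A special `G`-Frobenius algebra: all twisted sectors are cyclic `A_e`-modules
with chosen generators `1_g` and sections `i_g`. -/
structure SpecialGFrobenius (k G A : Type*)
    [Field k] [Group G] [DecidableEq G] [AddCommGroup A] [Module k A]
    extends GFrobenius k G A where
  oneg : G → A
  oneg_mem : ∀ g : G, oneg g ∈ grade g
  oneg_one : oneg 1 = one
  oneg_ne : ∀ g : G, oneg g ≠ 0
  iota : G → A →ₗ[k] A
  iota_mem : ∀ g : G, ∀ x ∈ grade g, iota g x ∈ grade 1
  iota_section : ∀ g : G, ∀ x ∈ grade g, mul (iota g x) (oneg g) = x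
  iota_module : ∀ g : G, ∀ a ∈ grade 1, ∀ b ∈ grade g,
      iota g (mul a b) = mul (iota g (mul a (oneg g))) (iota g b)
  phiScalar : G → G → k
  phi_oneg : ∀ g h : G, phi g (oneg h) = phiScalar g h • oneg (g * h * g⁻¹)
  phiScalar_one : ∀ g : G, phiScalar g 1 = 1

namespace SpecialGFrobenius

variable {k G A : Type*} [Field k] [Group G] [DecidableEq G] [AddCommGroup A] [Module k A]

/-- The restriction map `r_g : a ↦ a ∘ 1_g`. -/
def r (S : SpecialGFrobenius k G A) (g : G) : A →ₗ[k] A := S.mul.flip (S.oneg g)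

/-- The projection `π_g = i_g ∘ r_g`. -/
def proj (S : SpecialGFrobenius k G A) (g : G) : A →ₗ[k] A := (S.iota g).comp (S.r g)

/-- The cocycle `γ_{g,h} = i_{gh}(1_g ∘ 1_h)`. -/
def gam (S : SpecialGFrobenius k G A) (g h : G) : A :=
  S.iota (g * h) (S.mul (S.oneg g) (S.oneg h))

/-- The image `i_g(A_g) ⊆ A_e`. -/
def Bsub (S : SpecialGFrobenius k G A) (g : G) : Submodule k A :=
  (S.grade g).map (S.iota g)

end SpecialGFrobenius

namespace SpecialGFrobenius

variable {k G A : Type*} [Field k] [Group G] [DecidableEq G] [AddCommGroup A] [Module k A]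

theorem proj_apply (S : SpecialGFrobenius k G A) (g : G) (a : A) :
    S.proj g a = S.iota g (S.mul a (S.oneg g)) := rfl

theorem mul_mem_grade_one (S : SpecialGFrobenius k G A) {a b : A}
    (ha : a ∈ S.grade 1) (hb : b ∈ S.grade 1) : S.mul a b ∈ S.grade 1 := by
  simpa using S.mul_mem 1 1 a ha b hb

theorem mul_oneg_mem (S : SpecialGFrobenius k G A) (g : G) {a : A} (ha : a ∈ S.grade 1) :
    S.mul a (S.oneg g) ∈ S.grade g := by
  simpa using S.mul_mem 1 g a ha _ (S.oneg_mem g)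

theorem proj_mem (S : SpecialGFrobenius k G A) (g : G) {a : A} (ha : a ∈ S.grade 1) :
    S.proj g a ∈ S.grade 1 :=
  S.iota_mem g _ (S.mul_oneg_mem g ha)

theorem proj_mul_oneg (S : SpecialGFrobenius k G A) (g : G) {a : A} (ha : a ∈ S.grade 1) :
    S.mul (S.proj g a) (S.oneg g) = S.mul a (S.oneg g) :=
  S.iota_section g _ (S.mul_oneg_mem g ha)

theorem Bsub_le (S : SpecialGFrobenius k G A) (g : G) : S.Bsub g ≤ S.grade 1 := by
  rintro _ ⟨x, hx, rfl⟩
  exact S.iota_mem g x hx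

theorem gam_mem_Bsub (S : SpecialGFrobenius k G A) (g h : G) : S.gam g h ∈ S.Bsub (g * h) :=
  ⟨_, S.mul_mem g h _ (S.oneg_mem g) _ (S.oneg_mem h), rfl⟩

theorem gam_mem (S : SpecialGFrobenius k G A) (g h : G) : S.gam g h ∈ S.grade 1 :=
  S.Bsub_le _ (S.gam_mem_Bsub g h)

theorem gam_mul_oneg (S : SpecialGFrobenius k G A) (g h : G) :
    S.mul (S.gam g h) (S.oneg (g * h)) = S.mul (S.oneg g) (S.oneg h) :=
  S.iota_section _ _ (S.mul_mem g h _ (S.oneg_mem g) _ (S.oneg_mem h))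

/-- The untwisted sector commutes with every homogeneous element. -/
theorem mul_comm_of_mem_grade_one (S : SpecialGFrobenius k G A) (g : G) {a b : A}
    (ha : a ∈ S.grade 1) (hb : b ∈ S.grade g) : S.mul a b = S.mul b a := by
  simpa [S.phi_id] using S.twisted_comm 1 g a ha b hb

theorem mul_left_comm_of_mem_grade_one (S : SpecialGFrobenius k G A) (g : G) {a b : A} (c : A)
    (ha : a ∈ S.grade 1) (hb : b ∈ S.grade g) :
    S.mul a (S.mul b c) = S.mul b (S.mul a c) := by
  rw [← S.mul_assoc', S.mul_comm_of_mem_grade_one g ha hb, S.mul_assoc']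

theorem gam_mul_gam_mul_oneg_left (S : SpecialGFrobenius k G A) (g h l : G) :
    S.mul (S.mul (S.gam g h) (S.gam (g * h) l)) (S.oneg (g * h * l))
      = S.mul (S.oneg g) (S.mul (S.oneg h) (S.oneg l)) := by
  rw [S.mul_assoc', S.gam_mul_oneg, ← S.mul_assoc', S.gam_mul_oneg, S.mul_assoc']

theorem gam_mul_gam_mul_oneg_right (S : SpecialGFrobenius k G A) (g h l : G) :
    S.mul (S.mul (S.gam h l) (S.gam g (h * l))) (S.oneg (g * h * l))
      = S.mul (S.oneg g) (S.mul (S.oneg h) (S.oneg l)) := by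
  rw [S.mul_assoc', mul_assoc g h l, S.gam_mul_oneg,
    S.mul_left_comm_of_mem_grade_one g _ (S.gam_mem h l) (S.oneg_mem g), S.gam_mul_oneg]

/-- `π_{gh}` may be dropped in front of `1_g ∘ 1_h`. -/
theorem proj_mul_oneg_mul_oneg (S : SpecialGFrobenius k G A) (g h : G) {a : A}
    (ha : a ∈ S.grade 1) :
    S.mul (S.proj (g * h) a) (S.mul (S.oneg g) (S.oneg h))
      = S.mul a (S.mul (S.oneg g) (S.oneg h)) := by
  rw [← S.gam_mul_oneg,
    S.mul_left_comm_of_mem_grade_one 1 _ (S.proj_mem _ ha) (S.gam_mem g h), S.proj_mul_oneg _ ha,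
    S.mul_left_comm_of_mem_grade_one 1 _ ha (S.gam_mem g h)]

end SpecialGFrobenius

/-- the elements `γ_{g,h}` of a special `G`-Frobenius algebra (defined by
`1_g ∘ 1_h = γ_{g,h} ∘ 1_{gh}`, `γ_{g,h} ∈ i_{gh}(A_{gh})`) form an associative `G`-graded
2-cocycle with values in `A_e`. -/
theorem gamma_is_associative_graded_cocycle
    {k G A : Type*} [Field k] [CharZero k] [Group G] [DecidableEq G] [Fintype G]
    [AddCommGroup A] [Module k A] (S : SpecialGFrobenius k G A) :
    (∀ g h : G, S.gam g h ∈ S.Bsub (g * h)) ∧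
    (∀ g h : G, S.mul (S.oneg g) (S.oneg h) = S.mul (S.gam g h) (S.oneg (g * h))) ∧
    (∀ g h l : G,
        S.proj (g * h * l) (S.mul (S.gam g h) (S.gam (g * h) l))
          = S.proj (g * h * l) (S.mul (S.gam h l) (S.gam g (h * l)))) ∧
    (∀ g h l : G, ∀ a ∈ S.Bsub g, ∀ b ∈ S.Bsub h, ∀ c ∈ S.Bsub l,
        S.proj (g * h * l)
            (S.mul (S.mul (S.mul (S.proj (g * h) (S.mul a b)) c) (S.gam g h))
              (S.gam (g * h) l))
          = S.proj (g * h * l)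
              (S.mul (S.mul (S.mul a (S.proj (h * l) (S.mul b c))) (S.gam h l))
                (S.gam g (h * l)))) := by
  refine ⟨S.gam_mem_Bsub, fun g h => (S.gam_mul_oneg g h).symm, fun g h l => ?_,
    fun g h l a ha b hb c hc => ?_⟩
  · rw [S.proj_apply, S.proj_apply, S.gam_mul_gam_mul_oneg_left, S.gam_mul_gam_mul_oneg_right]
  · replace ha := S.Bsub_le g ha
    replace hb := S.Bsub_le h hb
    replace hc := S.Bsub_le l hc
    have hab := S.mul_mem_grade_one ha hb
    have hbc := S.mul_mem_grade_one hb hc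
    have left : S.mul (S.mul (S.mul (S.mul (S.proj (g * h) (S.mul a b)) c) (S.gam g h))
          (S.gam (g * h) l)) (S.oneg (g * h * l))
        = S.mul (S.mul a (S.mul b c)) (S.mul (S.oneg g) (S.mul (S.oneg h) (S.oneg l))) := by
      rw [S.mul_assoc' _ (S.gam g h), S.mul_assoc', S.gam_mul_gam_mul_oneg_left,
        S.mul_comm_of_mem_grade_one 1 (S.proj_mem _ hab) hc, S.mul_assoc' c,
        ← S.mul_assoc' (S.oneg g), ← S.mul_assoc' (S.proj _ _), S.proj_mul_oneg_mul_oneg g h hab,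
        S.mul_assoc' (S.mul a b), ← S.mul_assoc' c, S.mul_comm_of_mem_grade_one 1 hc hab,
        S.mul_assoc' a b c]
    have right : S.mul (S.mul (S.mul (S.mul a (S.proj (h * l) (S.mul b c))) (S.gam h l))
          (S.gam g (h * l))) (S.oneg (g * h * l))
        = S.mul (S.mul a (S.mul b c)) (S.mul (S.oneg g) (S.mul (S.oneg h) (S.oneg l))) := by
      rw [S.mul_assoc' _ (S.gam h l), S.mul_assoc', S.gam_mul_gam_mul_oneg_right,
        S.mul_assoc' a,
        S.mul_left_comm_of_mem_grade_one g _ (S.proj_mem _ hbc) (S.oneg_mem g),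
        S.proj_mul_oneg_mul_oneg h l hbc,
        ← S.mul_left_comm_of_mem_grade_one g _ hbc (S.oneg_mem g), ← S.mul_assoc' a]
    rw [S.proj_apply (g * h * l), S.proj_apply (g * h * l), left, right]
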